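/- If char(F) ≠ 2, 3, then the quadratic form Q_ω associated to a non-degenerate 3-form ω on F^7 satisfies 6 Q_ω(x) η = ω ∧ (ι_x ω) ∧ (ι_x ω) for all x ∈ F^7. -/

import Mathlib

open ExteriorAlgebra
open scoped LinearAlgebra.Projectivization

set_option synthInstance.maxHeartbeats 1000000

/-- Interior multiplication `ι_v` of a form (an element of the exterior algebra of the
dual space) by a vector `v`, characterized by `⟨ι_v α, β⟩ = ⟨α, v ∧ β⟩`. -/
noncomputable def iMul (F : Type*) [Field F] {V : Type*} [AddCommGroup V] [Module F V] (v : V) :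
    ExteriorAlgebra F (Module.Dual F V) →ₗ[F] ExteriorAlgebra F (Module.Dual F V) :=
  CliffordAlgebra.contractLeft (Module.Dual.eval F V v)

section ExteriorContraction

variable {F : Type*} [Field F] {V : Type*} [AddCommGroup V] [Module F V]

theorem iMul_ι_mul (v : V) (a : Module.Dual F V) (β : ExteriorAlgebra F (Module.Dual F V)) :
    iMul F v (ι F a * β) = a v • β - ι F a * iMul F v β := by
  simpa [iMul] using CliffordAlgebra.contractLeft_ι_mul (Q := (0 : QuadraticForm F _))
    (Module.Dual.eval F V v) a β

theorem iMul_iMul_self (v : V) (α : ExteriorAlgebra F (Module.Dual F V)) :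
    iMul F v (iMul F v α) = 0 :=
  CliffordAlgebra.contractLeft_contractLeft _ α

/-- Interior multiplication is an antiderivation. -/
theorem iMul_mul (v : V) {k : ℕ} {α : ExteriorAlgebra F (Module.Dual F V)}
    (hα : α ∈ ⋀[F]^k (Module.Dual F V)) (β : ExteriorAlgebra F (Module.Dual F V)) :
    iMul F v (α * β) = iMul F v α * β + (-1 : F) ^ k • (α * iMul F v β) := by
  induction k generalizing α with
  | zero =>
    obtain ⟨r, rfl⟩ := Submodule.mem_one.mp (by simpa using hα)
    simp [iMul, CliffordAlgebra.contractLeft_algebraMap_mul]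
  | succ k ih =>
    rw [exteriorPower, pow_succ'] at hα
    refine Submodule.mul_induction_on hα ?_ ?_
    · rintro _ ⟨a, rfl⟩ γ hγ
      rw [mul_assoc, iMul_ι_mul, iMul_ι_mul, ih hγ, pow_succ]
      simp only [mul_add, sub_mul, smul_mul_assoc, mul_smul_comm, mul_neg, mul_one, neg_smul,
        mul_assoc]
      abel
    · intro γ δ hγ hδ
      simp only [add_mul, map_add, hγ, hδ, smul_add]
      abel

/-- Interior multiplication lowers the degree by one. -/
theorem iMul_mem (v : V) {k : ℕ} {α : ExteriorAlgebra F (Module.Dual F V)}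
    (hα : α ∈ ⋀[F]^(k + 1) (Module.Dual F V)) : iMul F v α ∈ ⋀[F]^k (Module.Dual F V) := by
  induction k generalizing α with
  | zero =>
    rw [exteriorPower, zero_add, pow_one] at hα
    obtain ⟨a, rfl⟩ := hα
    rw [exteriorPower, pow_zero]
    have := iMul_ι_mul v a 1
    rw [mul_one] at this
    rw [this]
    simp only [iMul, CliffordAlgebra.contractLeft_one, mul_zero, sub_zero]
    exact Submodule.smul_mem _ (a v) (Submodule.one_le.mp le_rfl)
  | succ k ih =>
    rw [exteriorPower, pow_succ'] at hα
    refine Submodule.mul_induction_on hα ?_ ?_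
    · rintro _ ⟨a, rfl⟩ γ hγ
      rw [iMul_ι_mul]
      refine Submodule.sub_mem _ (Submodule.smul_mem _ _ hγ) ?_
      rw [exteriorPower, pow_succ']
      exact Submodule.mul_mem_mul ⟨a, rfl⟩ (ih hγ)
    · intro γ δ hγ hδ
      rw [map_add]
      exact Submodule.add_mem _ hγ hδ

/-- Euler's identity: contracting and wedging back multiplies a `k`-form by `k`. -/
theorem sum_ι_coord_mul_iMul {n : Type*} [Fintype n] (b : Module.Basis n F V) {k : ℕ}
    {α : ExteriorAlgebra F (Module.Dual F V)} (hα : α ∈ ⋀[F]^k (Module.Dual F V)) :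
    ∑ i, ι F (b.coord i) * iMul F (b i) α = (k : F) • α := by
  induction k generalizing α with
  | zero =>
    obtain ⟨r, rfl⟩ := Submodule.mem_one.mp (by simpa using hα)
    simp [iMul, CliffordAlgebra.contractLeft_algebraMap]
  | succ k ih =>
    rw [exteriorPower, pow_succ'] at hα
    refine Submodule.mul_induction_on hα ?_ ?_
    · rintro _ ⟨a, rfl⟩ γ hγ
      have hanti (i : n) : ι F (b.coord i) * (ι F a * iMul F (b i) γ) =
          -(ι F a * (ι F (b.coord i) * iMul F (b i) γ)) := by
        rw [← mul_assoc, ← mul_assoc, eq_neg_iff_add_eq_zero, ← add_mul, ι_add_mul_swap, zero_mul]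
      have ha : ∑ i, a (b i) • ι F (b.coord i) = ι F a := by
        simp only [← map_smul, ← map_sum]
        congr 1
        refine b.ext fun j => ?_
        classical
        simp
      simp only [iMul_ι_mul, mul_sub, hanti, sub_neg_eq_add, Finset.sum_add_distrib,
        ← Finset.mul_sum, ih hγ]
      simp only [mul_smul_comm, ← smul_mul_assoc, ← Finset.sum_mul, ha]
      push_cast
      simp only [add_smul, one_smul, add_mul, smul_mul_assoc, add_comm]
    · intro γ δ hγ hδ
      simp only [map_add, mul_add, Finset.sum_add_distrib, hγ, hδ, smul_add]

/-- A form whose degree is invertible is determined by its contractions. -/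
theorem eq_of_iMul_eq [FiniteDimensional F V] {k : ℕ} (hk : (k : F) ≠ 0)
    {α β : ExteriorAlgebra F (Module.Dual F V)}
    (hα : α ∈ ⋀[F]^k (Module.Dual F V)) (hβ : β ∈ ⋀[F]^k (Module.Dual F V))
    (h : ∀ v, iMul F v α = iMul F v β) : α = β := by
  have := sum_ι_coord_mul_iMul (Module.finBasis F V) hα
  simp only [h, sum_ι_coord_mul_iMul (Module.finBasis F V) hβ] at this
  exact (smul_right_injective _ hk this).symm

theorem commute_of_mem_exteriorPower_two {M : Type*} [AddCommGroup M] [Module F M]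
    {l : ExteriorAlgebra F M} (hl : l ∈ ⋀[F]^2 M) (α : ExteriorAlgebra F M) : Commute l α := by
  induction α using ExteriorAlgebra.induction with
  | algebraMap r => exact Algebra.commutes' r l |>.symm
  | ι c =>
    rw [exteriorPower, pow_two] at hl
    refine Submodule.mul_induction_on hl ?_ fun _ _ => Commute.add_left
    rintro _ ⟨a, rfl⟩ _ ⟨b, rfl⟩
    have hswap (x y : M) : ι F x * ι F y = -(ι F y * ι F x) :=
      eq_neg_of_add_eq_zero_left (ι_add_mul_swap x y)
    rw [Commute, SemiconjBy, mul_assoc, hswap b c, mul_neg, ← mul_assoc, hswap a c, neg_mul,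
      neg_neg, mul_assoc]
  | mul a b ha hb => exact ha.mul_right hb
  | add a b ha hb => exact ha.add_right hb

theorem pow_mem_exteriorPower {M : Type*} [AddCommGroup M] [Module F M] {k : ℕ}
    {l : ExteriorAlgebra F M} (hl : l ∈ ⋀[F]^k M) (n : ℕ) : l ^ n ∈ ⋀[F]^(k * n) M := by
  rw [exteriorPower, pow_mul]
  exact Submodule.pow_mem_pow _ hl n

theorem iMul_pow (v : V) {l : ExteriorAlgebra F (Module.Dual F V)}
    (hl : l ∈ ⋀[F]^2 (Module.Dual F V)) (n : ℕ) :
    iMul F v (l ^ (n + 1)) = ((n + 1 : ℕ) : F) • (iMul F v l * l ^ n) := by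
  induction n with
  | zero => simp
  | succ n ih =>
    rw [pow_succ' l (n + 1), iMul_mul v hl, ih, mul_smul_comm, ← mul_assoc,
      (commute_of_mem_exteriorPower_two hl _).eq, mul_assoc, ← pow_succ']
    push_cast
    simp only [add_smul, one_smul, even_two.neg_one_pow]
    abel

/-- In degrees where all of `2, 4, …, 2 * k` are invertible, the `k`-th Pfaffian of a 2-form
is its `k`-th divided power. -/
theorem factorial_smul_eq_pow [FiniteDimensional F V] {l : ExteriorAlgebra F (Module.Dual F V)}
    (hl : l ∈ ⋀[F]^2 (Module.Dual F V)) (P : ℕ → ExteriorAlgebra F (Module.Dual F V))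
    (h0 : P 0 = 1) (hmem : ∀ k, 1 ≤ k → P k ∈ ⋀[F]^(2 * k) (Module.Dual F V))
    (hP : ∀ k v, iMul F v (P (k + 1)) = iMul F v l * P k) {k : ℕ}
    (hk : ∀ j, 1 ≤ j → j ≤ k → ((2 * j : ℕ) : F) ≠ 0) :
    (k.factorial : F) • P k = l ^ k := by
  induction k with
  | zero => simp [h0]
  | succ k ih =>
    refine eq_of_iMul_eq (hk (k + 1) (by lia) le_rfl)
      (Submodule.smul_mem _ _ (hmem _ (by lia))) (pow_mem_exteriorPower hl _) fun v => ?_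
    rw [map_smul, hP, iMul_pow v hl, ← ih fun j h1 h2 => hk j h1 (by lia), mul_smul_comm,
      smul_smul, Nat.factorial_succ, Nat.cast_mul]

theorem exteriorPower_eq_bot {M : Type*} [AddCommGroup M] [Module F M] [FiniteDimensional F M]
    {n : ℕ} (hn : Module.finrank F M < n) : ⋀[F]^n M = ⊥ := by
  rw [← Submodule.finrank_eq_zero (R := F), exteriorPower.finrank_eq, Nat.choose_eq_zero_of_lt hn]

end ExteriorContraction

/-- If `char F ≠ 2, 3`, the quadratic form `Q_ω` associated to a
non-degenerate 3-form `ω` on `F^7` (via `H_η(Pf_3(ι_x ω)) = Q_ω(x)·x`) satisfies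
`6 Q_ω(x) η = ω ∧ (ι_x ω) ∧ (ι_x ω)` for all `x ∈ F^7`. -/
theorem quadratic_form_wedge_formula (F : Type*) [Field F]
    (h2 : (2 : F) ≠ 0) (h3 : (3 : F) ≠ 0)
    (Pf : ExteriorAlgebra F (Module.Dual F (Fin 7 → F)) → ℕ →
      ExteriorAlgebra F (Module.Dual F (Fin 7 → F)))
    (hPf0 : ∀ l, Pf l 0 = 1)
    (hPfmem : ∀ l ∈ ⋀[F]^2 (Module.Dual F (Fin 7 → F)), ∀ k : ℕ, 1 ≤ k →
      Pf l k ∈ ⋀[F]^(2 * k) (Module.Dual F (Fin 7 → F)))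
    (hPf : ∀ l ∈ ⋀[F]^2 (Module.Dual F (Fin 7 → F)), ∀ (k : ℕ) (v : Fin 7 → F),
      iMul F v (Pf l (k + 1)) = iMul F v l * Pf l k)
    (ω : ExteriorAlgebra F (Module.Dual F (Fin 7 → F)))
    (hω3 : ω ∈ ⋀[F]^3 (Module.Dual F (Fin 7 → F)))
    (hnd : ∀ x : Fin 7 → F, iMul F x ω = 0 → x = 0)
    (η : ExteriorAlgebra F (Module.Dual F (Fin 7 → F)))
    (hη7 : η ∈ ⋀[F]^7 (Module.Dual F (Fin 7 → F))) (hη : η ≠ 0)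
    (Hη : ExteriorAlgebra F (Module.Dual F (Fin 7 → F)) →ₗ[F] (Fin 7 → F))
    (hHη : ∀ α ∈ ⋀[F]^6 (Module.Dual F (Fin 7 → F)), ∀ β : Module.Dual F (Fin 7 → F),
      α * ExteriorAlgebra.ι F β = β (Hη α) • η)
    (Q : QuadraticForm F (Fin 7 → F))
    (hQ : ∀ x : Fin 7 → F, Hη (Pf (iMul F x ω) 3) = Q x • x) :
    ∀ x : Fin 7 → F, (6 : F) • Q x • η = ω * iMul F x ω * iMul F x ω := by
  intro x
  set l := iMul F x ω with hl_def
  have hl : l ∈ ⋀[F]^2 (Module.Dual F (Fin 7 → F)) := iMul_mem x hω3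
  rcases eq_or_ne x 0 with rfl | hx
  · have : l = 0 := by simp [hl_def, iMul]
    simp [this]
  obtain ⟨β, hβ⟩ := Module.Projective.exists_dual_ne_zero F hx
  have hPf3 : (6 : F) • Pf l 3 = l ^ 3 := by
    have h4 : (4 : F) ≠ 0 := by
      rw [show (4 : F) = 2 * 2 by norm_num]
      exact mul_ne_zero h2 h2
    have h6 : (6 : F) ≠ 0 := by
      rw [show (6 : F) = 2 * 3 by norm_num]
      exact mul_ne_zero h2 h3
    have := factorial_smul_eq_pow hl (Pf l) (hPf0 l) (hPfmem l hl) (hPf l hl) (k := 3) (by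
      intro j h1 h3
      interval_cases j <;> norm_num <;> assumption)
    simpa [Nat.factorial] using this
  have hleft : l ^ 3 * ι F β = β x • ((6 : F) • Q x • η) := by
    rw [← hPf3, smul_mul_assoc, hHη _ (hPfmem l hl 3 (by norm_num)), hQ, map_smul, smul_eq_mul,
      mul_comm, mul_smul, smul_comm]
  have hix : iMul F x (ω * l * l) = l ^ 3 := by
    have hil : iMul F x l = 0 := iMul_iMul_self x ω
    rw [mul_assoc, iMul_mul x hω3, iMul_mul x hl, hil]
    simp [← hl_def, pow_succ, mul_assoc]
  have htop : ι F β * (ω * l * l) = 0 := by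
    have hmem : ι F β * (ω * l * l) ∈ ⋀[F]^8 (Module.Dual F (Fin 7 → F)) := by
      rw [exteriorPower, show 8 = 1 + (3 + 2 + 2) by rfl, pow_add, pow_add, pow_add, pow_one]
      exact Submodule.mul_mem_mul ⟨β, rfl⟩
        (Submodule.mul_mem_mul (Submodule.mul_mem_mul hω3 hl) hl)
    rwa [exteriorPower_eq_bot (by rw [Subspace.dual_finrank_eq]; simp), Submodule.mem_bot] at hmem
  have hcontract := iMul_ι_mul x β (ω * l * l)
  rw [htop, map_zero, hix, ← ((commute_of_mem_exteriorPower_two hl (ι F β)).pow_left 3).eq, hleft,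
    eq_comm, sub_eq_zero] at hcontract
  exact (smul_right_injective _ hβ hcontract).symm
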